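/- Let (X,d,T) be a topological dynamical system, φ ∈ C(X,ℝ), and K ⊆ M(X,T) a closed subset. Then P({x ∈ X : A(L_n x) ∩ K ≠ ∅}, φ) ≤ sup{ h(T,μ) + ∫φ dμ : μ ∈ K }. -/

import Mathlib

open MeasureTheory Filter Topology Set
open scoped ENNReal

noncomputable section

/-- Birkhoff sum `S_m φ(x) = Σ_{i=0}^{m-1} φ(T^i x)`. -/
def birkhoffS {X : Type*} (T : X → X) (φ : X → ℝ) (m : ℕ) (x : X) : ℝ :=
  ∑ i ∈ Finset.range m, φ (T^[i] x)

/-- Bowen ball `B_m(x,ε) = {y : max_{0 ≤ i < m} D(T^i x, T^i y) ≤ ε}`, with respect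
to a distance function `D`. -/
def bowenBallD {X : Type*} (D : X → X → ℝ) (T : X → X) (x : X) (m : ℕ) (ε : ℝ) : Set X :=
  {y | ∀ i < m, D (T^[i] x) (T^[i] y) ≤ ε}

/-- `C` is an admissible (finite or countable) cover of `Z` by Bowen balls
`B_m(x,ε)` with `m ≥ n`. -/
def covOK {X : Type*} (D : X → X → ℝ) (T : X → X) (Z : Set X) (n : ℕ) (ε : ℝ)
    (C : Set (X × ℕ)) : Prop :=
  C.Countable ∧ (∀ p ∈ C, n ≤ p.2) ∧ Z ⊆ ⋃ p ∈ C, bowenBallD D T p.1 p.2 ε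

/-- `M(Z,t,φ,n,ε) = inf_C Σ exp(-t m + sup_{y ∈ B_m(x,ε)} S_m φ(y))`. -/
def Mpre {X : Type*} (D : X → X → ℝ) (T : X → X) (Z : Set X) (t : ℝ) (φ : X → ℝ)
    (n : ℕ) (ε : ℝ) : ℝ≥0∞ :=
  ⨅ (C : Set (X × ℕ)) (_ : covOK D T Z n ε C),
    ∑' p : C, ENNReal.ofReal
      (Real.exp (-t * ((p : X × ℕ).2 : ℝ) +
        sSup (birkhoffS T φ (p : X × ℕ).2 '' bowenBallD D T (p : X × ℕ).1 (p : X × ℕ).2 ε)))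

/-- `M(Z,t,φ,ε) = lim_n M(Z,t,φ,n,ε)` (the quantity is nondecreasing in `n`). -/
def Mlim {X : Type*} (D : X → X → ℝ) (T : X → X) (Z : Set X) (t : ℝ) (φ : X → ℝ)
    (ε : ℝ) : ℝ≥0∞ :=
  ⨆ n : ℕ, Mpre D T Z t φ n ε

/-- `P(Z,φ,ε)`: the critical value of `t ↦ M(Z,t,φ,ε)`. -/
def pressAt {X : Type*} (D : X → X → ℝ) (T : X → X) (Z : Set X) (φ : X → ℝ)
    (ε : ℝ) : EReal :=
  sInf {s : EReal | ∃ t : ℝ, s = (t : EReal) ∧ Mlim D T Z t φ ε = 0}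

/-- The Pesin–Pitskel topological pressure `P(Z,φ) = lim_{ε → 0⁺} P(Z,φ,ε)`
of an arbitrary subset `Z`, with respect to a distance function `D`. -/
def pressD {X : Type*} (D : X → X → ℝ) (T : X → X) (Z : Set X) (φ : X → ℝ) : EReal :=
  limsup (fun ε : ℝ => pressAt D T Z φ ε) (𝓝[>] 0)

/-- Topological pressure of a subset of a metric space. -/
def pressure {X : Type*} [MetricSpace X] (T : X → X) (Z : Set X) (φ : X → ℝ) : EReal :=
  pressD (fun a b => dist a b) T Z φ

/-- `N(Z,t,ψ,n,ε) = inf_C Σ exp(-t · sup_{y ∈ B_m(x,ε)} S_m ψ(y))`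
(the BS-dimension Carathéodory sum). -/
def Npre {X : Type*} (D : X → X → ℝ) (T : X → X) (Z : Set X) (t : ℝ) (ψ : X → ℝ)
    (n : ℕ) (ε : ℝ) : ℝ≥0∞ :=
  ⨅ (C : Set (X × ℕ)) (_ : covOK D T Z n ε C),
    ∑' p : C, ENNReal.ofReal
      (Real.exp (-t *
        sSup (birkhoffS T ψ (p : X × ℕ).2 '' bowenBallD D T (p : X × ℕ).1 (p : X × ℕ).2 ε)))

/-- `BS(Z,ψ,ε)`: critical value of `t ↦ lim_n N(Z,t,ψ,n,ε)`. -/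
def BSat {X : Type*} (D : X → X → ℝ) (T : X → X) (Z : Set X) (ψ : X → ℝ)
    (ε : ℝ) : EReal :=
  sInf {s : EReal | ∃ t : ℝ, s = (t : EReal) ∧ (⨆ n : ℕ, Npre D T Z t ψ n ε) = 0}

/-- The BS-dimension `BS(Z,ψ) = lim_{ε → 0⁺} BS(Z,ψ,ε)` of Barreira–Schmeling. -/
def BSdimD {X : Type*} (D : X → X → ℝ) (T : X → X) (Z : Set X) (ψ : X → ℝ) : EReal :=
  limsup (fun ε : ℝ => BSat D T Z ψ ε) (𝓝[>] 0)

/-- BS-dimension in a metric space. -/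
def BSdim {X : Type*} [MetricSpace X] (T : X → X) (Z : Set X) (ψ : X → ℝ) : EReal :=
  BSdimD (fun a b => dist a b) T Z ψ

end
open MeasureTheory Filter Topology Set
open scoped ENNReal

noncomputable section

/-- The `n`-th (here: `(n+1)`-st) empirical measure
`L_{n+1} x = (1/(n+1)) Σ_{k=0}^{n} δ_{T^k x}` as a Borel probability measure. -/
noncomputable def empPM {X : Type*} [MeasurableSpace X] (T : X → X) (x : X) (n : ℕ) :
    ProbabilityMeasure X :=
  ⟨((n + 1 : ℝ≥0∞))⁻¹ • ∑ k ∈ Finset.range (n + 1), Measure.dirac (T^[k] x), by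
    constructor
    rw [Measure.smul_apply, Measure.coe_finset_sum, Finset.sum_apply]
    simp only [measure_univ, Finset.sum_const, Finset.card_range, nsmul_eq_mul, mul_one]
    rw [smul_eq_mul]
    have h1 : ((n : ℝ≥0∞) + 1) ≠ 0 := by simp
    have h2 : ((n : ℝ≥0∞) + 1) ≠ ⊤ := by simp [ENNReal.add_ne_top]
    rw [show ((n + 1 : ℕ) : ℝ≥0∞) = (n : ℝ≥0∞) + 1 by push_cast; ring]
    exact ENNReal.inv_mul_cancel h1 h2⟩

/-- The set of accumulation (cluster) points of a sequence. -/
def accPts {Y : Type*} [TopologicalSpace Y] (u : ℕ → Y) : Set Y :=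
  {p | MapClusterPt p atTop u}

/-- `μ` is a `T`-invariant probability measure. -/
def InvMeas {X : Type*} [MeasurableSpace X] (T : X → X) (μ : ProbabilityMeasure X) : Prop :=
  (μ : Measure X).map T = (μ : Measure X)

/-- Entropy `H_μ` of the refined partition `⋁_{j=0}^{m-1} T^{-j} P` determined by a
finite measurable partition coded by `P : X → Fin k`. -/
noncomputable def partitionH {X : Type*} [MeasurableSpace X] (T : X → X) (μ : Measure X)
    {k : ℕ} (P : X → Fin k) (m : ℕ) : ℝ :=
  ∑ s : Fin m → Fin k,
    Real.negMulLog ((μ {x | ∀ j : Fin m, P (T^[(j : ℕ)] x) = s j}).toReal)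

/-- Kolmogorov–Sinai (measure-theoretic) entropy `h(T,μ)`: the supremum over finite
measurable partitions of `lim_n (1/n) H_μ(⋁_{j<n} T^{-j}P)`; by subadditivity
(Fekete) the limit equals the infimum. -/
noncomputable def entropyKS {X : Type*} [MeasurableSpace X] (T : X → X) (μ : Measure X) :
    ℝ≥0∞ :=
  ⨆ (k : ℕ) (P : X → Fin k) (_ : Measurable P),
    ⨅ n : ℕ, ENNReal.ofReal (partitionH T μ P (n + 1) / (n + 1))

/-- `Λ(y,φ) = sup { h(T,μ) + ∫ φ dμ : μ ∈ M(X,T), Ξ μ = y }`, with value `⊥ = -∞`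
when no invariant measure is mapped to `y` by `Ξ`. -/
noncomputable def Lam {X Y : Type*} [MeasurableSpace X] (T : X → X)
    (Ξ : ProbabilityMeasure X → Y) (φ : X → ℝ) (y : Y) : EReal :=
  ⨆ (μ : ProbabilityMeasure X) (_ : InvMeas T μ ∧ Ξ μ = y),
    ((entropyKS T (μ : Measure X) : ℝ≥0∞) : EReal) + ((∫ x, φ x ∂(μ : Measure X) : ℝ) : EReal)

end

lemma frontier_iInter_subset_iUnion {X ι : Type*} [TopologicalSpace X] [Finite ι]
    (s : ι → Set X) : frontier (⋂ i, s i) ⊆ ⋃ i, frontier (s i) := by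
  rintro x ⟨hcl, hint⟩
  rw [interior_iInter_of_finite, mem_iInter, not_forall] at hint
  obtain ⟨i, hi⟩ := hint
  exact mem_iUnion.2 ⟨i, closure_mono (iInter_subset s i) hcl, hi⟩

/-- A compact metric space has finite measurable partitions of arbitrarily small mesh
whose atoms have null boundary for a given finite measure. -/
lemma exists_partition_null_frontier {X : Type*} [MetricSpace X] [CompactSpace X]
    [MeasurableSpace X] [BorelSpace X] (μ : Measure X) [IsFiniteMeasure μ] {ε : ℝ} (hε : 0 < ε) :
    ∃ (k : ℕ) (P : X → Fin k), Measurable P ∧ (∀ i, μ (frontier (P ⁻¹' {i})) = 0) ∧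
      ∀ x y, P x = P y → dist x y ≤ ε := by
  classical
  have hr : ∀ x : X, ∃ r ∈ Ioo 0 (ε / 2), μ (frontier (Metric.ball x r)) = 0 := fun x => by
    simpa using exists_null_frontier_thickening μ {x} (half_pos hε)
  choose r hr hr0 using hr
  obtain ⟨t, ht⟩ := isCompact_univ.elim_finite_subcover (fun x => Metric.ball x (r x))
    (fun x => Metric.isOpen_ball) (fun x _ => mem_iUnion.2 ⟨x, Metric.mem_ball_self (hr x).1⟩)
  let e := Fintype.equivFin (t → Bool)
  let P : X → Fin (Fintype.card (t → Bool)) :=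
    fun x => e fun c => decide (x ∈ Metric.ball (c : X) (r c))
  have hfib : ∀ i, P ⁻¹' {i} = ⋂ c : t, {x | decide (x ∈ Metric.ball (c : X) (r c)) =
      e.symm i c} := by
    intro i
    ext x
    simp only [P, mem_preimage, mem_singleton_iff, mem_iInter, mem_ofPred_eq]
    rw [← Equiv.eq_symm_apply, funext_iff]
  have hatom : ∀ (c : t) (b : Bool), {x | decide (x ∈ Metric.ball (c : X) (r c)) = b} =
      if b then Metric.ball (c : X) (r c) else (Metric.ball (c : X) (r c))ᶜ := by
    intro c b
    cases b <;> ext x <;> simp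
  refine ⟨_, P, measurable_to_countable' fun i => ?_, fun i => ?_, fun x y hxy => ?_⟩
  · rw [hfib]
    refine MeasurableSet.iInter fun c => ?_
    rw [hatom]
    split_ifs
    · exact measurableSet_ball
    · exact measurableSet_ball.compl
  · rw [hfib]
    refine measure_mono_null (frontier_iInter_subset_iUnion _) (measure_iUnion_null fun c => ?_)
    rw [hatom]
    split_ifs
    · exact hr0 c
    · rw [frontier_compl]
      exact hr0 c
  · obtain ⟨c, hc, hxc⟩ := mem_iUnion₂.1 (ht (mem_univ x))
    have hy := congrFun (e.injective hxy) ⟨c, hc⟩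
    have hyc : y ∈ Metric.ball c (r c) := by simpa [hxc] using hy
    have h1 := Metric.mem_ball.1 hxc
    have h2 := Metric.mem_ball'.1 hyc
    have h3 := (hr c).2
    linarith [dist_triangle x c y]

/-- The itinerary of length `m` of a point with respect to a coding map `P`. -/
def itinerary {X A : Type*} (T : X → X) (P : X → A) (m : ℕ) (x : X) : Fin m → A :=
  fun j => P (T^[(j : ℕ)] x)

lemma itinerary_preimage {X A : Type*} (T : X → X) (P : X → A) (m : ℕ) (s : Fin m → A) :
    itinerary T P m ⁻¹' {s} = ⋂ j : Fin m, T^[(j : ℕ)] ⁻¹' (P ⁻¹' {s j}) := by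
  ext x
  simp [itinerary, funext_iff]

lemma null_frontier_itinerary {X : Type*} [TopologicalSpace X] [MeasurableSpace X]
    [BorelSpace X] {T : X → X} (hT : Continuous T) {μ : Measure X} (hμ : μ.map T = μ)
    {A : Type*} {P : X → A} (hP : ∀ i, μ (frontier (P ⁻¹' {i})) = 0) (m : ℕ) (s : Fin m → A) :
    μ (frontier (itinerary T P m ⁻¹' {s})) = 0 := by
  have hmp : MeasurePreserving T μ μ := ⟨hT.measurable, hμ⟩
  rw [itinerary_preimage]
  refine measure_mono_null (frontier_iInter_subset_iUnion _) (measure_iUnion_null fun j => ?_)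
  refine measure_mono_null ((hT.iterate j).frontier_preimage_subset _) ?_
  rw [(hmp.iterate j).measure_preimage isClosed_frontier.measurableSet.nullMeasurableSet]
  exact hP _

lemma integral_empPM {X : Type*} [MeasurableSpace X] [MeasurableSingletonClass X] (T : X → X)
    (x : X) (n : ℕ) (f : X → ℝ) :
    ∫ y, f y ∂(empPM T x n : Measure X) = (∑ i ∈ Finset.range (n + 1), f (T^[i] x)) / (n + 1) := by
  have h : (empPM T x n : Measure X) =
      ((n + 1 : ℝ≥0∞))⁻¹ • ∑ k ∈ Finset.range (n + 1), Measure.dirac (T^[k] x) := rfl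
  rw [h, integral_smul_measure, integral_finsetSum_measure fun i _ => integrable_dirac (by simp)]
  simp only [integral_dirac]
  have h1 : ((n + 1 : ℝ≥0∞)).toReal = (n + 1 : ℝ) := by
    rw [ENNReal.toReal_add (by simp) (by simp)]
    simp
  rw [ENNReal.toReal_inv, h1, smul_eq_mul, div_eq_inv_mul]

/-- The number of words whose information content is at most `R` is at most `exp R`. -/
lemma card_words_le_exp {A : Type*} [Fintype A] {p : A → ℝ} (hp : ∀ a, 0 < p a)
    (hp1 : ∑ a, p a = 1) (q : ℕ) (R : ℝ) :
    ((Finset.univ.filter fun b : Fin q → A => ∑ l, -Real.log (p (b l)) ≤ R).card : ℝ) ≤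
      Real.exp R := by
  classical
  have h1 : ∑ b : Fin q → A, ∏ l, p (b l) = 1 := by
    rw [← Fintype.sum_pow, hp1, one_pow]
  have h2 : ∀ b : Fin q → A, ∑ l, -Real.log (p (b l)) ≤ R → 1 ≤ Real.exp R * ∏ l, p (b l) := by
    intro b hb
    have h3 : ∏ l, p (b l) = Real.exp (-∑ l, -Real.log (p (b l))) := by
      rw [Finset.sum_neg_distrib, neg_neg, Real.exp_sum]
      exact Finset.prod_congr rfl fun l _ => (Real.exp_log (hp _)).symm
    rw [h3, ← Real.exp_add]
    exact Real.one_le_exp (by linarith)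
  calc ((Finset.univ.filter fun b : Fin q → A => ∑ l, -Real.log (p (b l)) ≤ R).card : ℝ)
      = ∑ b ∈ Finset.univ.filter fun b : Fin q → A => ∑ l, -Real.log (p (b l)) ≤ R, (1 : ℝ) := by
        simp
    _ ≤ ∑ b ∈ Finset.univ.filter fun b : Fin q → A => ∑ l, -Real.log (p (b l)) ≤ R,
          Real.exp R * ∏ l, p (b l) :=
        Finset.sum_le_sum fun b hb => h2 b (Finset.mem_filter.1 hb).2
    _ ≤ ∑ b : Fin q → A, Real.exp R * ∏ l, p (b l) :=
        Finset.sum_le_sum_of_subset_of_nonneg (Finset.filter_subset _ _) fun b _ _ =>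
          mul_nonneg (Real.exp_pos _).le (Finset.prod_nonneg fun l _ => (hp _).le)
    _ = Real.exp R := by rw [← Finset.mul_sum, h1, mul_one]

/-- Every probability vector is approximated by a strictly positive one, with cross entropy
close to the entropy. -/
lemma exists_pos_crossEntropy_lt {A : Type*} [Fintype A] {p : A → ℝ} (hp : ∀ a, 0 ≤ p a)
    (hp1 : ∑ a, p a = 1) {H : ℝ} (hH : ∑ a, Real.negMulLog (p a) < H) :
    ∃ p' : A → ℝ, (∀ a, 0 < p' a) ∧ ∑ a, p' a = 1 ∧ ∑ a, p a * -Real.log (p' a) < H := by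
  set δ := H - ∑ a, Real.negMulLog (p a) with hδ
  have hδ0 : 0 < δ := by linarith
  set N : ℝ := (Fintype.card A : ℝ) with hN
  have hN0 : 0 ≤ N := Nat.cast_nonneg _
  set η := δ / (N + 1) with hη
  have hη0 : 0 < η := by positivity
  have hNη : N * η < δ := by
    rw [hη, mul_div_assoc', div_lt_iff₀ (by positivity)]
    nlinarith
  have hc : 0 < 1 + N * η := by positivity
  refine ⟨fun a => (p a + η) / (1 + N * η), fun a => ?_, ?_, ?_⟩
  · have := hp a
    positivity
  · rw [← Finset.sum_div, Finset.sum_add_distrib, hp1, Finset.sum_const, Finset.card_univ,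
      nsmul_eq_mul, div_self hc.ne']
  · have key : ∀ a, p a * -Real.log ((p a + η) / (1 + N * η)) ≤
        Real.negMulLog (p a) + p a * (N * η) := by
      intro a
      rcases (hp a).eq_or_lt with h0 | h0
      · simp [← h0]
      · have hlog : Real.log (1 + N * η) ≤ N * η := by
          linarith [Real.log_le_sub_one_of_pos hc]
        have hmono : Real.log (p a) ≤ Real.log (p a + η) := Real.log_le_log h0 (by linarith)
        rw [Real.log_div (by positivity) hc.ne', Real.negMulLog]
        nlinarith
    calc _ ≤ ∑ a, (Real.negMulLog (p a) + p a * (N * η)) := Finset.sum_le_sum fun a _ => key a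
      _ = ∑ a, Real.negMulLog (p a) + N * η := by
        rw [Finset.sum_add_distrib, ← Finset.sum_mul, hp1, one_mul]
      _ < H := by linarith

/-- One of the `m` phases has at most the average weight. -/
lemma exists_phase_sum_le {a : ℕ → ℝ} (ha : ∀ i, 0 ≤ a i) {m : ℕ} (hm : 0 < m) {N : ℕ} {c : ℝ}
    (h : ∑ i ∈ Finset.range N, a i ≤ m * c) :
    ∃ j < m, ∑ l ∈ Finset.range (N / m), a (j + l * m) ≤ c := by
  have hblock : ∀ q, ∑ i ∈ Finset.range (q * m), a i =
      ∑ l ∈ Finset.range q, ∑ j ∈ Finset.range m, a (j + l * m) := by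
    intro q
    induction q with
    | zero => simp
    | succ q ih =>
      rw [Nat.succ_mul, Finset.sum_range_add, ih, Finset.sum_range_succ]
      simp [add_comm]
  have h1 : ∑ j ∈ Finset.range m, ∑ l ∈ Finset.range (N / m), a (j + l * m) ≤
      ∑ _j ∈ Finset.range m, c := by
    rw [Finset.sum_comm, ← hblock, Finset.sum_const, Finset.card_range, nsmul_eq_mul]
    refine le_trans (Finset.sum_le_sum_of_subset_of_nonneg ?_ fun i _ _ => ha i) h
    exact Finset.range_mono (Nat.div_mul_le_self N m)
  obtain ⟨j, hj, hjc⟩ := Finset.exists_le_of_sum_le (by simpa using hm.ne') h1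
  exact ⟨j, Finset.mem_range.1 hj, hjc⟩

/-- A long itinerary is determined by its consecutive blocks from some phase on, together
with its initial and its final block. -/
lemma apply_iterate_eq_of_blocks_eq {X A : Type*} {T : X → X} {P : X → A} {m : ℕ} (hm : 0 < m)
    {N j : ℕ} (hj : j < m) {x y : X} (h0 : itinerary T P m x = itinerary T P m y)
    (hb : ∀ l < N / m, itinerary T P m (T^[j + l * m] x) = itinerary T P m (T^[j + l * m] y))
    (h1 : itinerary T P m (T^[N / m * m] x) = itinerary T P m (T^[N / m * m] y))
    {i : ℕ} (hi : i < N) : P (T^[i] x) = P (T^[i] y) := by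
  rcases lt_or_ge i j with hij | hij
  · exact congrFun h0 ⟨i, hij.trans hj⟩
  rcases lt_or_ge i (N / m * m) with hiq | hiq
  · have hl : (i - j) / m < N / m := by
      rw [Nat.div_lt_iff_lt_mul hm]
      omega
    have h2 := congrFun (hb _ hl) ⟨(i - j) % m, Nat.mod_lt _ hm⟩
    have h3 : (i - j) % m + (j + (i - j) / m * m) = i := by
      have := Nat.mod_add_div' (i - j) m
      omega
    simpa only [itinerary, ← Function.iterate_add_apply, h3] using h2
  · have h4 : i - N / m * m < m := by
      have := Nat.lt_div_mul_add hm (a := N)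
      omega
    have h2 := congrFun h1 ⟨i - N / m * m, h4⟩
    have h3 : i - N / m * m + N / m * m = i := by omega
    simpa only [itinerary, ← Function.iterate_add_apply, h3] using h2

/-- Points whose empirical measure is close to an invariant measure `μ` with `h(T,μ) < c` can be
covered by about `exp (c n)` Bowen balls of length `n`. -/
lemma exists_nhds_card_cover_le {X : Type*} [MetricSpace X] [CompactSpace X] [MeasurableSpace X]
    [BorelSpace X] {T : X → X} (hT : Continuous T) {μ : ProbabilityMeasure X} (hμ : InvMeas T μ)
    {ε : ℝ} (hε : 0 < ε) {c : ℝ} (hc : entropyKS T (μ : Measure X) < ENNReal.ofReal c) :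
    ∃ F ∈ 𝓝 μ, ∃ C : ℝ, ∀ n : ℕ, ∀ G ⊆ {x | empPM T x n ∈ F}, ∃ E : Finset X,
      (E.card : ℝ) ≤ C * Real.exp (c * (n + 1)) ∧ (E : Set X) ⊆ G ∧
      ∀ x ∈ G, ∃ e ∈ E, x ∈ bowenBallD (fun a b => dist a b) T e (n + 1) ε := by
  classical
  obtain ⟨k, P, hPm, hP0, hPε⟩ := exists_partition_null_frontier (μ : Measure X) hε
  have hPc : ⨅ n : ℕ, ENNReal.ofReal (partitionH T (μ : Measure X) P (n + 1) / (n + 1)) <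
      ENNReal.ofReal c := by
    refine lt_of_le_of_lt ?_ hc
    exact le_iSup_of_le k (le_iSup_of_le P (le_iSup_of_le hPm le_rfl))
  obtain ⟨n₀, hn₀⟩ := iInf_lt_iff.1 hPc
  have hH : partitionH T (μ : Measure X) P (n₀ + 1) < (n₀ + 1 : ℕ) * c := by
    have h := lt_of_not_ge fun h => not_le_of_gt hn₀ (ENNReal.ofReal_le_ofReal h)
    rw [div_lt_iff₀ (by positivity)] at h
    push_cast
    linarith
  clear hn₀ hPc hc
  generalize hm' : n₀ + 1 = m at hH
  have hm : 0 < m := by omega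
  clear hm'
  have hmeas : ∀ s, MeasurableSet (itinerary T P m ⁻¹' {s}) := fun s => by
    rw [itinerary_preimage]
    exact MeasurableSet.iInter fun j => (hT.iterate j).measurable (hPm (measurableSet_singleton _))
  have hsum : ∑ s, (μ : Measure X).real (itinerary T P m ⁻¹' {s}) = 1 := by
    rw [← measureReal_biUnion_finset (fun s _ t _ hst => ?_) fun s _ => hmeas s]
    · simp [← preimage_iUnion, iUnion_of_singleton]
    · exact Disjoint.preimage _ (disjoint_singleton.2 hst)
  have hHsum : ∑ s, Real.negMulLog ((μ : Measure X).real (itinerary T P m ⁻¹' {s})) < m * c := by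
    convert! hH using 1
    refine Finset.sum_congr rfl fun s _ => ?_
    congr 3
    ext x
    simp [itinerary, funext_iff]
  obtain ⟨p, hp0, hp1, hpH⟩ := exists_pos_crossEntropy_lt (fun s => measureReal_nonneg) hsum hHsum
  have hg0 : ∀ s, 0 ≤ -Real.log (p s) := fun s => by
    have : p s ≤ 1 := hp1 ▸ Finset.single_le_sum (fun a _ => (hp0 a).le) (Finset.mem_univ s)
    linarith [Real.log_nonpos (hp0 s).le this]
  have hF : {ν : ProbabilityMeasure X | ∑ s, (ν : Measure X).real (itinerary T P m ⁻¹' {s}) *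
      -Real.log (p s) < m * c} ∈ 𝓝 μ := by
    have ht : Tendsto (fun ν : ProbabilityMeasure X =>
        ∑ s, (ν : Measure X).real (itinerary T P m ⁻¹' {s}) * -Real.log (p s)) (𝓝 μ)
        (𝓝 (∑ s, (μ : Measure X).real (itinerary T P m ⁻¹' {s}) * -Real.log (p s))) := by
      refine tendsto_finsetSum _ fun s _ => Tendsto.mul_const _ ?_
      exact (ENNReal.tendsto_toReal (measure_ne_top _ _)).comp
        (ProbabilityMeasure.tendsto_measure_of_null_frontier_of_tendsto' tendsto_id
          (null_frontier_itinerary hT hμ hP0 m s))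
    exact ht.eventually (gt_mem_nhds hpH)
  let a : ℝ := Fintype.card (Fin m → Fin k)
  refine ⟨_, hF, m * a * a, fun n G hG => ?_⟩
  have hphase : ∀ x ∈ G, ∃ j < m, ∑ l ∈ Finset.range ((n + 1) / m),
      -Real.log (p (itinerary T P m (T^[j + l * m] x))) ≤ c * (n + 1) := by
    intro x hx
    refine exists_phase_sum_le (a := fun i => -Real.log (p (itinerary T P m (T^[i] x))))
      (fun i => hg0 _) hm ?_
    have h1 := hG hx
    simp only [mem_ofPred_eq] at h1
    have h2 : ∀ s, (empPM T x n : Measure X).real (itinerary T P m ⁻¹' {s}) =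
        (∑ i ∈ Finset.range (n + 1), if itinerary T P m (T^[i] x) = s then (1 : ℝ) else 0) /
          (n + 1) := by
      intro s
      rw [← integral_indicator_one (hmeas s), integral_empPM]
      simp [indicator_apply]
    have h3 : ∑ s, (empPM T x n : Measure X).real (itinerary T P m ⁻¹' {s}) * -Real.log (p s) =
        (∑ i ∈ Finset.range (n + 1), -Real.log (p (itinerary T P m (T^[i] x)))) / (n + 1) := by
      simp_rw [h2, div_mul_eq_mul_div, ← Finset.sum_div, Finset.sum_mul]
      rw [Finset.sum_comm]
      simp
    rw [h3, div_lt_iff₀ (by positivity)] at h1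
    linarith
  choose! j hj hjc using hphase
  let d : X → ℕ × (Fin m → Fin k) × (Fin ((n + 1) / m) → Fin m → Fin k) × (Fin m → Fin k) := fun x => (j x, itinerary T P m x,
    fun l => itinerary T P m (T^[j x + l * m] x), itinerary T P m (T^[(n + 1) / m * m] x))
  let B : Finset (Fin ((n + 1) / m) → Fin m → Fin k) :=
    Finset.univ.filter fun b => ∑ l, -Real.log (p (b l)) ≤ c * (n + 1)
  let S : Finset (ℕ × (Fin m → Fin k) × (Fin ((n + 1) / m) → Fin m → Fin k) ×
      (Fin m → Fin k)) := Finset.range m ×ˢ Finset.univ ×ˢ B ×ˢ Finset.univ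
  have hdS : d '' G ⊆ S := by
    rintro _ ⟨x, hx, rfl⟩
    have h := hjc x hx
    rw [Finset.sum_range] at h
    simp only [S, B, d, Finset.coe_product, mem_prod, Finset.mem_coe, Finset.mem_range,
      Finset.mem_univ, Finset.mem_filter, true_and, and_true]
    exact ⟨hj x hx, h⟩
  obtain ⟨E, hEG, hE⟩ := exists_subset_bijOn G d
  have hEfin : E.Finite :=
    Set.Finite.of_finite_image (S.finite_toSet.subset (hE.image_eq ▸ hdS)) hE.injOn
  lift E to Finset X using hEfin
  refine ⟨E, ?_, hEG, fun x hx => ?_⟩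
  · have h1 : E.card ≤ S.card := by
      refine Finset.card_le_card_of_injOn d (fun e he => ?_) hE.injOn
      exact hdS ⟨e, hEG he, rfl⟩
    have h2 : (S.card : ℝ) = m * a * a * B.card := by
      simp only [S, Finset.card_product, Finset.card_range, Finset.card_univ, a]
      push_cast
      ring
    calc (E.card : ℝ) ≤ S.card := by exact_mod_cast h1
      _ = m * a * a * B.card := h2
      _ ≤ _ := by
        gcongr
        exact card_words_le_exp hp0 hp1 _ _
  · obtain ⟨e, he, hex⟩ := hE.surjOn ⟨x, hx, rfl⟩
    refine ⟨e, he, fun i hi => hPε _ _ ?_⟩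
    simp only [d, Prod.mk.injEq] at hex
    obtain ⟨hej, he0, heb, he1⟩ := hex
    refine apply_iterate_eq_of_blocks_eq hm (hj x hx) he0 (fun l hl => ?_) he1 hi
    have := congrFun heb ⟨l, hl⟩
    simpa only [hej] using this

lemma sSup_birkhoffS_bowenBall_le {X : Type*} {D : X → X → ℝ} (hD : ∀ x, D x x = 0) {T : X → X}
    {φ : X → ℝ} {ε κ : ℝ} (hε : 0 ≤ ε) (hκ : ∀ x y, D x y ≤ ε → φ y ≤ φ x + κ) (m : ℕ) (x : X) :
    sSup (birkhoffS T φ m '' bowenBallD D T x m ε) ≤ birkhoffS T φ m x + m * κ := by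
  refine csSup_le ⟨_, x, fun i _ => by rw [hD]; exact hε, rfl⟩ ?_
  rintro _ ⟨y, hy, rfl⟩
  calc birkhoffS T φ m y ≤ ∑ i ∈ Finset.range m, (φ (T^[i] x) + κ) :=
        Finset.sum_le_sum fun i hi => hκ _ _ (hy i (Finset.mem_range.1 hi))
    _ = birkhoffS T φ m x + m * κ := by simp [birkhoffS, Finset.sum_add_distrib]

/-- If, for each large length, `Z` is covered infinitely often by finite families of Bowen balls
with summable weights, then the critical value is at most `t`. -/
lemma pressAt_le_of_frequently_cover {X : Type*} {D : X → X → ℝ} {T : X → X} {Z : Set X}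
    {φ : X → ℝ} {ε t : ℝ} (w : ℕ → ℝ≥0∞) (hw : ∑' n, w n ≠ ∞) (E : ℕ → Finset X)
    (hE : ∀ n, ∑ e ∈ E n, ENNReal.ofReal (Real.exp (-t * ((n + 1 : ℕ) : ℝ) +
      sSup (birkhoffS T φ (n + 1) '' bowenBallD D T e (n + 1) ε))) ≤ w n)
    (hZ : ∀ x ∈ Z, ∃ᶠ n in atTop, ∃ e ∈ E n, x ∈ bowenBallD D T e (n + 1) ε) :
    pressAt D T Z φ ε ≤ t := by
  classical
  refine sInf_le ⟨t, rfl, ?_⟩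
  rw [Mlim, ENNReal.iSup_eq_zero]
  intro n
  refine le_antisymm ?_ zero_le
  refine ge_of_tendsto (ENNReal.tendsto_sum_nat_add w hw) ?_
  filter_upwards [eventually_ge_atTop n] with M hM
  let C : ℕ → Finset (X × ℕ) := fun i => (E (i + M)).image fun e => (e, i + M + 1)
  have hcov : covOK D T Z n ε (⋃ i, (C i : Set (X × ℕ))) := by
    refine ⟨countable_iUnion fun i => (C i).countable_toSet, fun p hp => ?_, fun x hx => ?_⟩
    · obtain ⟨i, hi⟩ := mem_iUnion.1 hp
      obtain ⟨e, -, rfl⟩ := Finset.mem_image.1 (Finset.mem_coe.1 hi)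
      simp only
      omega
    · obtain ⟨i, hi, e, he, hxe⟩ := frequently_atTop.1 (hZ x hx) M
      obtain ⟨i, rfl⟩ := Nat.exists_eq_add_of_le' hi
      exact mem_iUnion₂.2 ⟨(e, i + M + 1),
        mem_iUnion.2 ⟨i, Finset.mem_coe.2 (Finset.mem_image_of_mem _ he)⟩, hxe⟩
  let f : X × ℕ → ℝ≥0∞ := fun p => ENNReal.ofReal (Real.exp (-t * (p.2 : ℝ) +
    sSup (birkhoffS T φ p.2 '' bowenBallD D T p.1 p.2 ε)))
  calc Mpre D T Z t φ n ε ≤ ∑' p : (⋃ i, (C i : Set (X × ℕ)) : Set (X × ℕ)), f p := iInf₂_le _ hcov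
    _ ≤ ∑' i, ∑' p : (C i : Set (X × ℕ)), f p := ENNReal.tsum_iUnion_le_tsum f _
    _ ≤ ∑' i, w (i + M) := ENNReal.tsum_le_tsum fun i => by
      rw [Finset.tsum_subtype' (C i) f, Finset.sum_image (by simp)]
      exact hE (i + M)

lemma continuous_integral_probabilityMeasure {X : Type*} [TopologicalSpace X] [CompactSpace X]
    [MeasurableSpace X] [OpensMeasurableSpace X] {φ : X → ℝ} (hφ : Continuous φ) :
    Continuous fun ν : ProbabilityMeasure X => ∫ x, φ x ∂(ν : Measure X) :=
  continuous_iff_continuousAt.2 fun _ =>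
    ProbabilityMeasure.tendsto_iff_forall_integral_tendsto.1 tendsto_id
      (BoundedContinuousFunction.mkOfCompact ⟨φ, hφ⟩)

/-- Near an invariant measure `μ` with `h(T,μ) + ∫ φ dμ < s`, the weighted Bowen ball covers of
the points with empirical measure near `μ` are exponentially small. -/
lemma exists_isOpen_weighted_cover_le {X : Type*} [MetricSpace X] [CompactSpace X]
    [MeasurableSpace X] [BorelSpace X] {T : X → X} (hT : Continuous T) {φ : X → ℝ}
    (hφ : Continuous φ) {μ : ProbabilityMeasure X} (hμ : InvMeas T μ) {s ε κ : ℝ} (hε : 0 < ε)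
    (hκ : ∀ x y, dist x y ≤ ε → φ y ≤ φ x + κ)
    (hs : ((entropyKS T (μ : Measure X) : ℝ≥0∞) : EReal) +
      ((∫ x, φ x ∂(μ : Measure X) : ℝ) : EReal) < s) :
    ∃ U, IsOpen U ∧ μ ∈ U ∧ ∃ C : ℝ, ∀ n : ℕ, ∃ E : Finset X,
      (∑ e ∈ E, ENNReal.ofReal (Real.exp (-(s + 2 * κ) * ((n + 1 : ℕ) : ℝ) +
        sSup (birkhoffS T φ (n + 1) '' bowenBallD (fun a b => dist a b) T e (n + 1) ε))) ≤
          ENNReal.ofReal C * ENNReal.ofReal (Real.exp (-κ)) ^ n) ∧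
      ∀ x, empPM T x n ∈ U → ∃ e ∈ E, x ∈ bowenBallD (fun a b => dist a b) T e (n + 1) ε := by
  obtain ⟨c, hc, hcs⟩ : ∃ c : ℝ, entropyKS T (μ : Measure X) < ENNReal.ofReal c ∧
      c + ∫ x, φ x ∂(μ : Measure X) < s := by
    generalize entropyKS T (μ : Measure X) = h at hs
    generalize ∫ x, φ x ∂(μ : Measure X) = b at hs
    induction h with
    | top => simp at hs
    | coe h =>
      have hs' : (h : ℝ) + b < s := by
        rw [EReal.coe_nnreal_eq_coe_real] at hs
        exact_mod_cast hs
      refine ⟨(h + (s - b)) / 2, ?_, by linarith⟩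
      rw [← ENNReal.ofReal_coe_nnreal]
      have := h.coe_nonneg
      exact (ENNReal.ofReal_lt_ofReal_iff (by linarith)).2 (by linarith)
  obtain ⟨F, hF, C, hC⟩ := exists_nhds_card_cover_le hT hμ hε hc
  obtain ⟨U, hUF, hU, hμU⟩ := mem_nhds_iff.1 hF
  have hV : IsOpen {ν : ProbabilityMeasure X | ∫ x, φ x ∂(ν : Measure X) < s - c} :=
    isOpen_lt (continuous_integral_probabilityMeasure hφ) continuous_const
  have hC0 : 0 ≤ C := by
    obtain ⟨E, hE, -⟩ := hC 0 ∅ (empty_subset _)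
    exact nonneg_of_mul_nonneg_left ((Nat.cast_nonneg _).trans hE) (Real.exp_pos _)
  refine ⟨U ∩ {ν | ∫ x, φ x ∂(ν : Measure X) < s - c}, hU.inter hV, ⟨hμU, ?_⟩,
    C * Real.exp (-κ), fun n => ?_⟩
  · simp only [mem_ofPred_eq]
    linarith
  obtain ⟨E, hEC, hEG, hEcov⟩ := hC n
    {x | empPM T x n ∈ U ∩ {ν : ProbabilityMeasure X | ∫ x, φ x ∂(ν : Measure X) < s - c}}
    fun x hx => hUF hx.1
  refine ⟨E, ?_, hEcov⟩
  have hterm : ∀ e ∈ E, ENNReal.ofReal (Real.exp (-(s + 2 * κ) * ((n + 1 : ℕ) : ℝ) +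
      sSup (birkhoffS T φ (n + 1) '' bowenBallD (fun a b => dist a b) T e (n + 1) ε))) ≤
      ENNReal.ofReal (Real.exp (-(c + κ) * (n + 1))) := by
    intro e he
    refine ENNReal.ofReal_le_ofReal (Real.exp_le_exp.2 ?_)
    have h1 := (hEG he).2
    rw [mem_ofPred_eq, integral_empPM, div_lt_iff₀ (by positivity)] at h1
    have h2 := sSup_birkhoffS_bowenBall_le (T := T) (D := fun a b : X => dist a b) dist_self hε.le
      hκ (n + 1) e
    rw [birkhoffS] at h2
    push_cast at h2 ⊢
    linarith
  refine (Finset.sum_le_sum hterm).trans ?_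
  rw [Finset.sum_const, nsmul_eq_mul, ← ENNReal.ofReal_pow (Real.exp_pos _).le,
    ← ENNReal.ofReal_mul (by positivity), ← ENNReal.ofReal_natCast,
    ← ENNReal.ofReal_mul (Nat.cast_nonneg _)]
  refine ENNReal.ofReal_le_ofReal ?_
  calc (E.card : ℝ) * Real.exp (-(c + κ) * (n + 1))
      ≤ C * Real.exp (c * (n + 1)) * Real.exp (-(c + κ) * (n + 1)) := by gcongr
    _ = C * Real.exp (-κ) * Real.exp (-κ) ^ n := by
      rw [← Real.exp_nat_mul, mul_assoc, mul_assoc, ← Real.exp_add, ← Real.exp_add]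
      congr 2
      ring

/-- A compact set of invariant measures with `h(T,μ) + ∫ φ dμ < s` bounds the pressure, at a scale
where `φ` oscillates by at most `κ`, of the points whose empirical measures accumulate there. -/
lemma pressAt_accPts_inter_le {X : Type*} [MetricSpace X] [CompactSpace X]
    [MeasurableSpace X] [BorelSpace X] {T : X → X} (hT : Continuous T) {φ : X → ℝ}
    (hφ : Continuous φ) {K : Set (ProbabilityMeasure X)} (hK : IsCompact K)
    (hKinv : K ⊆ {μ | InvMeas T μ}) {s ε κ : ℝ} (hε : 0 < ε) (hκ0 : 0 < κ)
    (hκ : ∀ x y, dist x y ≤ ε → φ y ≤ φ x + κ)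
    (hs : ∀ μ ∈ K, ((entropyKS T (μ : Measure X) : ℝ≥0∞) : EReal) +
      ((∫ x, φ x ∂(μ : Measure X) : ℝ) : EReal) < s) :
    pressAt (fun a b => dist a b) T
      {x : X | ((accPts fun n => empPM T x n) ∩ K).Nonempty} φ ε ≤ (s + 2 * κ : ℝ) := by
  classical
  obtain ⟨U, hU, hKU, C, hC⟩ : ∃ U, IsOpen U ∧ K ⊆ U ∧ ∃ C : ℝ, ∀ n : ℕ, ∃ E : Finset X,
      (∑ e ∈ E, ENNReal.ofReal (Real.exp (-(s + 2 * κ) * ((n + 1 : ℕ) : ℝ) +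
        sSup (birkhoffS T φ (n + 1) '' bowenBallD (fun a b => dist a b) T e (n + 1) ε))) ≤
          ENNReal.ofReal C * ENNReal.ofReal (Real.exp (-κ)) ^ n) ∧
      ∀ x, empPM T x n ∈ U → ∃ e ∈ E, x ∈ bowenBallD (fun a b => dist a b) T e (n + 1) ε := by
    refine hK.induction_on ⟨∅, isOpen_empty, subset_rfl, 0, fun n => ⟨∅, by simp, by simp⟩⟩
      (fun A B hAB ⟨U, hU, hBU, h⟩ => ⟨U, hU, hAB.trans hBU, h⟩) ?_ ?_
    · rintro A B ⟨U, hU, hAU, C, hC⟩ ⟨V, hV, hBV, C', hC'⟩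
      refine ⟨U ∪ V, hU.union hV, union_subset_union hAU hBV, max C 0 + max C' 0, fun n => ?_⟩
      obtain ⟨E, hE, hEU⟩ := hC n
      obtain ⟨E', hE', hEV⟩ := hC' n
      refine ⟨E ∪ E', ?_, ?_⟩
      · refine (le_self_add.trans_eq (Finset.sum_union_inter (s₁ := E) (s₂ := E'))).trans ?_
        rw [ENNReal.ofReal_add (le_max_right _ _) (le_max_right _ _), add_mul]
        refine (add_le_add hE hE').trans ?_
        gcongr <;> exact le_max_left _ _
      · rintro x (hx | hx)
        · obtain ⟨e, he, hxe⟩ := hEU x hx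
          exact ⟨e, Finset.mem_union_left _ he, hxe⟩
        · obtain ⟨e, he, hxe⟩ := hEV x hx
          exact ⟨e, Finset.mem_union_right _ he, hxe⟩
    · intro μ hμ
      obtain ⟨U, hU, hμU, h⟩ :=
        exists_isOpen_weighted_cover_le hT hφ (hKinv hμ) hε hκ (hs μ hμ)
      exact ⟨U, mem_nhdsWithin_of_mem_nhds (hU.mem_nhds hμU), U, hU, subset_rfl, h⟩
  choose E hE hEU using hC
  refine pressAt_le_of_frequently_cover
    (fun n => ENNReal.ofReal C * ENNReal.ofReal (Real.exp (-κ)) ^ n) ?_ E hE ?_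
  · rw [ENNReal.tsum_mul_left, ENNReal.tsum_geometric]
    refine ENNReal.mul_ne_top ENNReal.ofReal_ne_top (ENNReal.inv_ne_top.2 ?_)
    refine (tsub_pos_of_lt ?_).ne'
    rw [ENNReal.ofReal_lt_one, Real.exp_lt_one_iff]
    linarith
  · rintro x ⟨μ, hμx, hμK⟩
    have hfreq : ∃ᶠ n in atTop, empPM T x n ∈ U :=
      mapClusterPt_iff_frequently.1 hμx U (hU.mem_nhds (hKU hμK))
    exact hfreq.mono fun n hn => hEU n x hn

/-- If `K ⊆ M(X,T)` is closed, then
`P({x : A(L_n x) ∩ K ≠ ∅}, φ) ≤ sup_{μ ∈ K} (h(T,μ) + ∫ φ dμ)`. -/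
theorem pressure_accPts_inter_le_sup
    {X : Type*} [MetricSpace X] [CompactSpace X] [MeasurableSpace X] [BorelSpace X]
    (T : X → X) (hT : Continuous T) (φ : X → ℝ) (hφ : Continuous φ)
    (K : Set (ProbabilityMeasure X)) (hKcl : IsClosed K) (hKinv : K ⊆ {μ | InvMeas T μ}) :
    pressure T {x : X | ((accPts fun n => empPM T x n) ∩ K).Nonempty} φ ≤
      ⨆ μ ∈ K, (((entropyKS T (μ : Measure X) : ℝ≥0∞) : EReal) +
        ((∫ x, φ x ∂(μ : Measure X) : ℝ) : EReal)) := by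
  refine EReal.le_of_forall_lt_iff_le.1 fun s hs => ?_
  obtain ⟨s', hs', hss'⟩ := EReal.lt_iff_exists_real_btwn.1 hs
  rw [EReal.coe_lt_coe_iff] at hss'
  have hκ0 : 0 < (s - s') / 2 := by linarith
  obtain ⟨δ, hδ, hφδ⟩ := Metric.uniformContinuous_iff.1
    (CompactSpace.uniformContinuous_of_continuous hφ) _ hκ0
  refine limsup_le_of_le (by isBoundedDefault) ?_
  filter_upwards [Ioo_mem_nhdsGT hδ] with ε hε
  have h := pressAt_accPts_inter_le hT hφ hKcl.isCompact hKinv hε.1 hκ0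
    (fun x y hxy => by
      have := hφδ (hxy.trans_lt hε.2)
      rw [Real.dist_eq, abs_lt] at this
      linarith) (s := s')
    fun μ hμ => (le_iSup₂ (f := fun (μ : ProbabilityMeasure X) (_ : μ ∈ K) =>
      ((entropyKS T (μ : Measure X) : ℝ≥0∞) : EReal) +
        ((∫ x, φ x ∂(μ : Measure X) : ℝ) : EReal)) μ hμ).trans_lt hs'
  rwa [show s' + 2 * ((s - s') / 2) = s by ring] at h
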